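/- Let Θ be a finite nonempty parameter set. For each θ ∈ Θ and each sample n let Δⁿ(θ) ∈ ℝ^T be deterministic with sup_{n,θ} ‖Δⁿ(θ)‖₂ bounded, and let εⁿ ∼ 𝒩(0, Σ_P) be i.i.d. zero-mean Gaussian vectors in ℝ^T. Define f_nd^N(θ) = (1/N) Σ_{n=1}^N ‖Δⁿ(θ) + εⁿ‖₂² and f_nf^N(θ) = (1/N) Σ_{n=1}^N ‖Δⁿ(θ)‖₂². Suppose there exist θ* ∈ Θ and δ > 0 such that for all N large enough and all θ ≠ θ*, f_nf^N(θ) ≥ f_nf^N(θ*) + δ. Then the probability that θ* is a minimizer of f_nd^N over Θ tends to 1 as N → ∞; in particular any (measurable) selection of minimizers of f_nd^N converges in probability to the minimizer of f_nf^N. -/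

import Mathlib

open MeasureTheory ProbabilityTheory Filter
open scoped RealInnerProductSpace

noncomputable section

/-- A random vector `X` in `ℝ^T` (modeled as `EuclideanSpace ℝ (Fin T)`) is Gaussian with
mean vector `μ` and covariance matrix `S` if it is measurable and every one-dimensional
projection `⟪a, X⟫` is a real Gaussian with mean `⟪a, μ⟫` and variance `aᵀ S a`. -/
def IsGaussianVec {Ω : Type*} [MeasurableSpace Ω] {T : ℕ} (P : Measure Ω)
    (X : Ω → EuclideanSpace ℝ (Fin T)) (μ : EuclideanSpace ℝ (Fin T))
    (S : Matrix (Fin T) (Fin T) ℝ) : Prop :=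
  Measurable X ∧
  ∀ a : EuclideanSpace ℝ (Fin T),
    P.map (fun ω => ⟪a, X ω⟫) =
      gaussianReal ⟪a, μ⟫ (Real.toNNReal (dotProduct (a : Fin T → ℝ) (S.mulVec a)))

/-- The noisy objective `f_nd^N(θ)(ω) = (1/N) Σ_{n<N} ‖Δⁿ(θ) + εⁿ(ω)‖²`. -/
def fnd {Ω : Type*} {Θ : Type*} {T : ℕ}
    (Δ : ℕ → Θ → EuclideanSpace ℝ (Fin T)) (ε : ℕ → Ω → EuclideanSpace ℝ (Fin T))
    (N : ℕ) (θ : Θ) (ω : Ω) : ℝ :=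
  (1 / (N : ℝ)) * ∑ n ∈ Finset.range N, ‖Δ n θ + ε n ω‖ ^ 2

/-- The noise-free objective `f_nf^N(θ) = (1/N) Σ_{n<N} ‖Δⁿ(θ)‖²`. -/
def fnf {Θ : Type*} {T : ℕ}
    (Δ : ℕ → Θ → EuclideanSpace ℝ (Fin T)) (N : ℕ) (θ : Θ) : ℝ :=
  (1 / (N : ℝ)) * ∑ n ∈ Finset.range N, ‖Δ n θ‖ ^ 2

lemma quad_bound {T : ℕ} (S : Matrix (Fin T) (Fin T) ℝ) (a : EuclideanSpace ℝ (Fin T)) (D : ℝ)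
    (ha : ‖a‖ ≤ D) :
    dotProduct (a : Fin T → ℝ) (S.mulVec a) ≤ (∑ i, ∑ j, |S i j|) * D ^ 2 := by
  have hc : ∀ i, |a i| ≤ D := fun i => by
    have := PiLp.norm_apply_le a i
    rw [Real.norm_eq_abs] at this
    linarith
  have hD : 0 ≤ D := le_trans (norm_nonneg _) ha
  simp only [dotProduct, Matrix.mulVec, Finset.mul_sum, Finset.sum_mul]
  refine Finset.sum_le_sum fun i _ => Finset.sum_le_sum fun j _ => ?_
  calc a i * (S i j * a j) ≤ |a i * (S i j * a j)| := le_abs_self _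
    _ = |S i j| * (|a i| * |a j|) := by rw [abs_mul, abs_mul]; ring
    _ ≤ |S i j| * (D * D) := by
        gcongr
        · exact hc i
        · exact hc j
    _ = |S i j| * D ^ 2 := by ring

lemma fnd_sub {Ω : Type*} {Θ : Type*} {T : ℕ}
    (Δ : ℕ → Θ → EuclideanSpace ℝ (Fin T)) (ε : ℕ → Ω → EuclideanSpace ℝ (Fin T))
    (N : ℕ) (θ θ' : Θ) (ω : Ω) :
    fnd Δ ε N θ ω - fnd Δ ε N θ' ω = fnf Δ N θ - fnf Δ N θ' +
      (2 / (N : ℝ)) * ∑ n ∈ Finset.range N, ⟪Δ n θ - Δ n θ', ε n ω⟫ := by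
  simp only [fnd, fnf, norm_add_sq_real, inner_sub_left, Finset.sum_add_distrib,
    Finset.sum_sub_distrib, ← Finset.mul_sum]
  ring

lemma bad_tendsto {Ω : Type*} [MeasurableSpace Ω] {T : ℕ}
    (P : Measure Ω) [IsProbabilityMeasure P]
    (a : ℕ → EuclideanSpace ℝ (Fin T)) (D : ℝ) (ha : ∀ n, ‖a n‖ ≤ D)
    (ε : ℕ → Ω → EuclideanSpace ℝ (Fin T))
    (SP : Matrix (Fin T) (Fin T) ℝ)
    (hgauss : ∀ n, IsGaussianVec P (ε n) 0 SP)
    (hindep : iIndepFun (m := fun _ : ℕ => inferInstance) ε P)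
    (δ : ℝ) (hδ : 0 < δ) :
    Tendsto (fun N : ℕ => P {ω | δ * N ≤ |∑ n ∈ Finset.range N, ⟪a n, ε n ω⟫|}) atTop
      (nhds 0) := by
  set V : ℝ := (∑ i, ∑ j, |SP i j|) * D ^ 2 with hV
  have hV0 : 0 ≤ V := by positivity
  let Y : ℕ → Ω → ℝ := fun n ω => ⟪a n, ε n ω⟫
  have hYm : ∀ n, Measurable (Y n) := fun n =>
    (measurable_const.inner (hgauss n).1)
  have hmap : ∀ n, P.map (Y n) =
      gaussianReal 0 (Real.toNNReal (dotProduct (a n : Fin T → ℝ) (SP.mulVec (a n)))) := fun n => by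
    have := (hgauss n).2 (a n)
    rw [inner_zero_right] at this
    exact this
  have hYL : ∀ n, MemLp (Y n) 2 P := fun n => by
    have h := memLp_id_gaussianReal (μ := 0)
      (v := Real.toNNReal (dotProduct (a n : Fin T → ℝ) (SP.mulVec (a n)))) 2
    rw [← hmap n] at h
    exact (memLp_map_measure_iff h.1 (hYm n).aemeasurable).1 h
  have hYE : ∀ n, ∫ ω, Y n ω ∂P = 0 := fun n => by
    have h := integral_id_gaussianReal (μ := 0)
      (v := Real.toNNReal (dotProduct (a n : Fin T → ℝ) (SP.mulVec (a n))))
    rw [← hmap n, integral_map (hYm n).aemeasurable (by fun_prop)] at h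
    exact h
  have hYV : ∀ n, Var[Y n; P] ≤ V := fun n => by
    have h := variance_id_gaussianReal (μ := 0)
      (v := Real.toNNReal (dotProduct (a n : Fin T → ℝ) (SP.mulVec (a n))))
    rw [← hmap n, variance_map (by fun_prop) (hYm n).aemeasurable] at h
    have h2 : Var[Y n; P] = _ := h
    rw [h2, Real.coe_toNNReal']
    exact max_le (quad_bound SP (a n) D (ha n)) hV0
  have hYI : iIndepFun Y P :=
    hindep.comp (fun n x => ⟪a n, x⟫) (fun n => by fun_prop)
  have key : ∀ N : ℕ, 0 < N → P {ω | δ * N ≤ |∑ n ∈ Finset.range N, ⟪a n, ε n ω⟫|} ≤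
      ENNReal.ofReal (V / δ ^ 2 / N) := by
    intro N hN
    have hN' : (0 : ℝ) < N := by exact_mod_cast hN
    have hS : MemLp (∑ n ∈ Finset.range N, Y n) 2 P := memLp_finsetSum' _ fun n _ => hYL n
    have hch := meas_ge_le_variance_div_sq hS (c := δ * N) (by positivity)
    have hE : P[∑ n ∈ Finset.range N, Y n] = 0 := by
      simp only [Finset.sum_apply]
      rw [integral_finset_sum _ fun n _ => (hYL n).integrable (by norm_num)]
      simp [hYE]
    have hvar : Var[∑ n ∈ Finset.range N, Y n; P] ≤ N * V := by
      rw [IndepFun.variance_sum (fun n _ => hYL n) (fun i _ j _ hij => hYI.indepFun hij)]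
      calc _ ≤ ∑ n ∈ Finset.range N, V := Finset.sum_le_sum fun n _ => hYV n
        _ = N * V := by simp
    rw [hE] at hch
    simp only [sub_zero, Finset.sum_apply] at hch
    refine hch.trans (ENNReal.ofReal_le_ofReal ?_)
    calc _ ≤ N * V / (δ * N) ^ 2 := by gcongr
      _ = V / δ ^ 2 / N := by field_simp
  have hlim : Tendsto (fun N : ℕ => ENNReal.ofReal (V / δ ^ 2 / N)) atTop (nhds 0) := by
    have := (ENNReal.continuous_ofReal.tendsto 0).comp
      (tendsto_const_div_atTop_nhds_zero_nat (V / δ ^ 2))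
    rw [ENNReal.ofReal_zero] at this
    exact this
  refine tendsto_of_tendsto_of_tendsto_of_le_of_le' tendsto_const_nhds hlim
    (Eventually.of_forall fun _ => zero_le) ?_
  filter_upwards [eventually_gt_atTop 0] with N hN using key N hN

/-- Over a finite parameter set `Θ`, with uniformly bounded deterministic
deviations `Δⁿ(θ)` and i.i.d. zero-mean Gaussian noise `εⁿ ∼ 𝒩(0, Σ_P)`, if `θ*` is an
eventually strictly separated minimizer of the noise-free objective, then the probability that
`θ*` minimizes the noisy objective `f_nd^N` tends to `1`, and any measurable selection of
minimizers of `f_nd^N` converges in probability to `θ*` (the minimizer of `f_nf^N`). -/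
theorem statement2 {Ω : Type*} [MeasurableSpace Ω] {T : ℕ}
    {Θ : Type*} [Fintype Θ] [Nonempty Θ] [MeasurableSpace Θ] [MeasurableSingletonClass Θ]
    (P : Measure Ω) [IsProbabilityMeasure P]
    (Δ : ℕ → Θ → EuclideanSpace ℝ (Fin T)) (C : ℝ) (hΔ : ∀ n θ, ‖Δ n θ‖ ≤ C)
    (ε : ℕ → Ω → EuclideanSpace ℝ (Fin T))
    (SP : Matrix (Fin T) (Fin T) ℝ)
    (hgauss : ∀ n, IsGaussianVec P (ε n) 0 SP)
    (hindep : iIndepFun (m := fun _ : ℕ => inferInstance) ε P)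
    (θstar : Θ) (δ : ℝ) (hδ : 0 < δ)
    (hgap : ∀ᶠ N in atTop, ∀ θ : Θ, θ ≠ θstar → fnf Δ N θstar + δ ≤ fnf Δ N θ) :
    Tendsto (fun N => P {ω | ∀ θ : Θ, fnd Δ ε N θstar ω ≤ fnd Δ ε N θ ω}) atTop (nhds 1) ∧
    ∀ sel : ℕ → Ω → Θ, (∀ N, Measurable (sel N)) →
      (∀ N ω, ∀ θ : Θ, fnd Δ ε N (sel N ω) ω ≤ fnd Δ ε N θ ω) →
      Tendsto (fun N => P {ω | sel N ω ≠ θstar}) atTop (nhds 0) := by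
  classical
  let B : ℕ → Set Ω := fun N => ⋃ θ : Θ,
    {ω | (δ / 4) * N ≤ |∑ n ∈ Finset.range N, ⟪Δ n θ - Δ n θstar, ε n ω⟫|}
  have hB : Tendsto (fun N => P (B N)) atTop (nhds 0) := by
    have h1 : Tendsto (fun N : ℕ => ∑ θ : Θ,
        P {ω | (δ / 4) * N ≤ |∑ n ∈ Finset.range N, ⟪Δ n θ - Δ n θstar, ε n ω⟫|}) atTop
        (nhds (∑ _θ : Θ, 0)) :=
      tendsto_finsetSum _ fun θ _ => bad_tendsto P (fun n => Δ n θ - Δ n θstar) (C + C)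
        (fun n => (norm_sub_le _ _).trans (add_le_add (hΔ n θ) (hΔ n θstar))) ε SP hgauss hindep
        (δ / 4) (by positivity)
    rw [Finset.sum_const_zero] at h1
    exact tendsto_of_tendsto_of_tendsto_of_le_of_le tendsto_const_nhds h1
      (fun _ => zero_le) (fun N => measure_iUnion_fintype_le P _)
  have hgood : ∀ᶠ N in atTop, ∀ ω, ω ∉ B N → ∀ θ : Θ, θ ≠ θstar →
      fnd Δ ε N θstar ω < fnd Δ ε N θ ω := by
    filter_upwards [hgap, eventually_gt_atTop 0] with N hN hN0 ω hω θ hθ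
    have hN' : (0 : ℝ) < N := by exact_mod_cast hN0
    have h1 := hN θ hθ
    have h2 := fnd_sub Δ ε N θ θstar ω
    simp only [B, Set.mem_iUnion, Set.mem_setOf_eq, not_exists, not_le] at hω
    have h3 := (abs_lt.1 (hω θ)).1
    have h4 : -(δ / 2) ≤
        (2 / (N : ℝ)) * ∑ n ∈ Finset.range N, ⟪Δ n θ - Δ n θstar, ε n ω⟫ := by
      calc -(δ / 2) = (2 / (N : ℝ)) * (-(δ / 4 * N)) := by field_simp; norm_num
        _ ≤ _ := by gcongr
    linarith
  constructor
  · have hlow : Tendsto (fun N => 1 - P (B N)) atTop (nhds 1) := by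
      have := ENNReal.Tendsto.sub (tendsto_const_nhds (x := (1 : ENNReal))) hB
        (Or.inl ENNReal.one_ne_top)
      simpa using this
    refine tendsto_of_tendsto_of_tendsto_of_le_of_le' hlow tendsto_const_nhds ?_
      (Eventually.of_forall fun _ => prob_le_one)
    filter_upwards [hgood] with N hN
    rw [tsub_le_iff_right, ← measure_univ (μ := P)]
    refine (measure_mono fun ω _ => ?_).trans (measure_union_le _ (B N))
    by_cases hω : ω ∈ B N
    · exact Or.inr hω
    · refine Or.inl fun θ => ?_
      by_cases hθ : θ = θstar
      · rw [hθ]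
      · exact (hN ω hω θ hθ).le
  · intro sel _ hsel
    refine tendsto_of_tendsto_of_tendsto_of_le_of_le' tendsto_const_nhds hB
      (Eventually.of_forall fun _ => zero_le) ?_
    filter_upwards [hgood] with N hN
    refine measure_mono fun ω hω => ?_
    by_contra hb
    exact absurd (hsel N ω θstar) (not_le.2 (hN ω hb _ hω))
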